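/- Let Γ be a semicomplete multipartite commutative weakly distance-regular digraph and let T={q : (1,q−1)∈∂̃(Γ)}. Then T={3}, T={4}, T={3,4}, or T={2,3}. -/

import Mathlib

open Set Matrix

namespace Paper

variable {V : Type*} {W : Type*}

/-- There is a directed walk of length `n` from `x` to `y` in the digraph with arc relation `A`. -/
def HasPathOfLength (A : V → V → Prop) (x y : V) (n : ℕ) : Prop :=
  ∃ p : ℕ → V, p 0 = x ∧ p n = y ∧ ∀ i < n, A (p i) (p (i + 1))

/-- A digraph is strongly connected if there is a directed path between any two vertices. -/
def IsStronglyConnected (A : V → V → Prop) : Prop :=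
  ∀ x y, ∃ n, HasPathOfLength A x y n

/-- The distance `∂(x,y)`: the length of a shortest directed path from `x` to `y`. -/
noncomputable def ddist (A : V → V → Prop) (x y : V) : ℕ :=
  sInf {n | HasPathOfLength A x y n}

/-- The two-way distance `∂̃(x,y) = (∂(x,y), ∂(y,x))`. -/
noncomputable def tdist (A : V → V → Prop) (x y : V) : ℕ × ℕ :=
  (ddist A x y, ddist A y x)

/-- The two-way distance set `∂̃(Γ)`. -/
def tdistSet (A : V → V → Prop) : Set (ℕ × ℕ) :=
  {d | ∃ x y, tdist A x y = d}

/-- The number `p_{ĩ,j̃}(x,y) = |{z : ∂̃(x,z) = ĩ, ∂̃(z,y) = j̃}|`. -/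
noncomputable def pnum (A : V → V → Prop) (i j : ℕ × ℕ) (x y : V) : ℕ :=
  {z | tdist A x z = i ∧ tdist A z y = j}.ncard

/-- A weakly distance-regular digraph. -/
def IsWDRD (A : V → V → Prop) : Prop :=
  IsStronglyConnected A ∧
  (∃ d ∈ tdistSet A, d.1 ≠ d.2) ∧
  ∀ i j : ℕ × ℕ, ∀ x y x' y' : V,
    tdist A x y = tdist A x' y' → pnum A i j x y = pnum A i j x' y'

/-- Commutativity of the attached scheme: `p_{ĩ,j̃}^{h̃} = p_{j̃,ĩ}^{h̃}`. -/
def IsCommutativeDigraph (A : V → V → Prop) : Prop :=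
  ∀ i j : ℕ × ℕ, ∀ x y : V, pnum A i j x y = pnum A j i x y

/-- A commutative weakly distance-regular digraph. -/
def IsCWDRD (A : V → V → Prop) : Prop :=
  IsWDRD A ∧ IsCommutativeDigraph A

/-- `A` is semicomplete multipartite with partition given by `f` (parts are the fibres). -/
def IsSemicompleteMultipartiteWith (A : V → V → Prop) {m : ℕ} (f : V → Fin m) : Prop :=
  (∀ x, ¬ A x x) ∧ (∀ i, 2 ≤ {x | f x = i}.ncard) ∧
  ∀ x y : V, x ≠ y → ((A x y ∨ A y x) ↔ f x ≠ f y)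

/-- A semicomplete multipartite digraph: the vertex set is partitioned into `m ≥ 2` partite
sets, each of size at least `2`, and two distinct vertices are joined by an arc in at least
one direction iff they lie in different partite sets. -/
def IsSemicompleteMultipartite (A : V → V → Prop) : Prop :=
  ∃ m : ℕ, 2 ≤ m ∧ ∃ f : V → Fin m, IsSemicompleteMultipartiteWith A f

/-- A semicomplete digraph: any two distinct vertices are joined by an arc in
at least one direction. -/
def IsSemicomplete (A : V → V → Prop) : Prop :=
  (∀ x, ¬ A x x) ∧ ∀ x y : V, x ≠ y → A x y ∨ A y x

/-- A circuit of length `n`: a sequence `w₀,…,w_{n-1}` with consecutive arcs and an arc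
from `w_{n-1}` back to `w₀`. -/
def HasCircuitOfLength (A : V → V → Prop) (n : ℕ) : Prop :=
  ∃ p : ℕ → V, p n = p 0 ∧ ∀ i < n, A (p i) (p (i + 1))

/-- The girth: the length of a shortest circuit. -/
noncomputable def girth (A : V → V → Prop) : ℕ :=
  sInf {n | 1 ≤ n ∧ HasCircuitOfLength A n}

/-- Lexicographic product of digraphs. -/
def lexProd (A : V → V → Prop) (B : W → W → Prop) : V × W → V × W → Prop :=
  fun u v => A u.1 v.1 ∨ (u.1 = v.1 ∧ B u.2 v.2)

/-- The `n`-coclique extension of a digraph: `A ∘ K̄ₙ`. -/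
def cocliqueExt (A : V → V → Prop) (n : ℕ) : V × Fin n → V × Fin n → Prop :=
  lexProd A (fun _ _ : Fin n => False)

/-- Isomorphism of digraphs. -/
def Iso (A : V → V → Prop) (B : W → W → Prop) : Prop :=
  ∃ e : V ≃ W, ∀ x y : V, A x y ↔ B (e x) (e y)

/-- An `(m,r)`-team semicomplete multipartite digraph with partite sets the fibres of `f`:
`m ≥ 2` parts, each of size `r ≥ 2`. -/
def IsTeamSMD (A : V → V → Prop) {m : ℕ} (f : V → Fin m) (r : ℕ) : Prop :=
  2 ≤ m ∧ 2 ≤ r ∧ (∀ x, ¬ A x x) ∧ (∀ i : Fin m, {x | f x = i}.ncard = r) ∧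
  ∀ x y : V, x ≠ y → ((A x y ∨ A y x) ↔ f x ≠ f y)

/-- Regular of valency `k`: every vertex has exactly `k` out-neighbours and `k`
in-neighbours. -/
def IsRegularOfValency (A : V → V → Prop) (k : ℕ) : Prop :=
  ∀ x : V, {y | A x y}.ncard = k ∧ {y | A y x}.ncard = k

open Classical in
/-- Adjacency matrix of the symmetric part `EΓ`. -/
noncomputable def matE (A : V → V → Prop) : Matrix V V ℤ :=
  Matrix.of fun x y => if A x y ∧ A y x then 1 else 0

open Classical in
/-- Adjacency matrix of the asymmetric part `A⃗Γ`. -/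
noncomputable def matAr (A : V → V → Prop) : Matrix V V ℤ :=
  Matrix.of fun x y => if A x y ∧ ¬ A y x then 1 else 0

open Classical in
/-- Adjacency matrix of a digraph. -/
noncomputable def matAdj (A : V → V → Prop) : Matrix V V ℤ :=
  Matrix.of fun x y => if A x y then 1 else 0

/-- The all-ones matrix `J`. -/
def matJ (V : Type*) : Matrix V V ℤ := Matrix.of fun _ _ => 1

open Classical in
/-- The matrix equations in the definition of a doubly regular team semicomplete multipartite
digraph, with constants `t, αᵢ, βᵢ, γᵢ, ηᵢ` (`A₀ = matE A`, `A₁ = matAr A`). -/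
def DRConstEq [Fintype V] (A : V → V → Prop) (t : ℤ) (α β γ η : ℕ → ℤ) : Prop :=
  ∀ i j : Fin 2,
    ![matE A, matAr A] i * ![matE A, matAr A] j =
      (if (i : ℕ) + (j : ℕ) = 0 then t else 0) • (1 : Matrix V V ℤ) +
      α ((i : ℕ) + (j : ℕ)) • matAr A +
      β ((i : ℕ) + (j : ℕ)) • (matAr A)ᵀ +
      γ ((i : ℕ) + (j : ℕ)) • matE A +
      η ((i : ℕ) + (j : ℕ)) • (matJ V - 1 - matAr A - (matAr A)ᵀ - matE A)

/-- A doubly regular `(m,r)`-team semicomplete multipartite digraph. -/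
def IsDoublyRegularTeamSMD [Fintype V] (A : V → V → Prop) {m : ℕ} (f : V → Fin m)
    (r : ℕ) : Prop :=
  IsTeamSMD A f r ∧ (∃ k, IsRegularOfValency A k) ∧
  ∃ t α β γ η, DRConstEq A t α β γ η

/-- `A_j⁺(x)`: out-neighbours of `x` in the part `j` via single arcs. -/
def Aplus (A : V → V → Prop) {m : ℕ} (f : V → Fin m) (j : Fin m) (x : V) : Set V :=
  {y | f y = j ∧ A x y ∧ ¬ A y x}

/-- `E_j(x)`: neighbours of `x` in the part `j` via edges (pairs of opposite arcs). -/
def Epart (A : V → V → Prop) {m : ℕ} (f : V → Fin m) (j : Fin m) (x : V) : Set V :=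
  {y | f y = j ∧ A x y ∧ A y x}

/-- Type I: `β₁+β₂-α₁-α₂ = r` and the digraph is an `r`-coclique extension of a
semicomplete digraph. -/
def TypeI (A : V → V → Prop) (r : ℕ) (α β : ℕ → ℤ) : Prop :=
  β 1 + β 2 - α 1 - α 2 = (r : ℤ) ∧
  ∃ (N : ℕ) (S : Fin N → Fin N → Prop),
    1 ≤ N ∧ IsSemicomplete S ∧ Iso A (cocliqueExt S r)

/-- Type II: `β₁+β₂-α₁-α₂ = 0` and `c_{ij} = c_{ji} = (r - e_{ij})/2` for all pairs `i ≠ j`. -/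
def TypeII (A : V → V → Prop) {m : ℕ} (f : V → Fin m) (r : ℕ) (α β : ℕ → ℤ) : Prop :=
  β 1 + β 2 - α 1 - α 2 = 0 ∧
  ∀ i j : Fin m, i ≠ j → ∃ c e : ℕ,
    (∀ x, f x = i → (Aplus A f j x).ncard = c ∧ (Epart A f j x).ncard = e) ∧
    (∀ y, f y = j → (Aplus A f i y).ncard = c) ∧
    c + c + e = r

/-- Condition (ii) of Type III for the ordered pair `(i,j)`: `V_i` splits as
`V_i' ∪ V_i''` with `(V_i' × V_j) ∪ (V_j × V_i'') ⊆ A⃗Γ`. -/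
def TypeIIIsplitB (A : V → V → Prop) {m : ℕ} (f : V → Fin m) (i j : Fin m) : Prop :=
  ∃ S : Set V, S ⊆ {x | f x = i} ∧ S.Nonempty ∧ ({x | f x = i} \ S).Nonempty ∧
    (∀ x ∈ S, ∀ y : V, f y = j → A x y ∧ ¬ A y x) ∧
    (∀ y : V, f y = j → ∀ x ∈ {x | f x = i} \ S, A y x ∧ ¬ A x y)

/-- Condition (iii) of Type III for the pair `(i,j)`. -/
def TypeIIIsplitC (A : V → V → Prop) {m : ℕ} (f : V → Fin m) (i j : Fin m) : Prop :=
  ∃ S T' : Set V,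
    S ⊆ {x | f x = i} ∧ S.Nonempty ∧ ({x | f x = i} \ S).Nonempty ∧
    T' ⊆ {y | f y = j} ∧ T'.Nonempty ∧ ({y | f y = j} \ T').Nonempty ∧
    (∀ x ∈ S, ∀ y ∈ T', A x y ∧ A y x) ∧
    (∀ x ∈ {x | f x = i} \ S, ∀ y ∈ {y | f y = j} \ T', A x y ∧ A y x) ∧
    (∀ x ∈ S, ∀ y ∈ {y | f y = j} \ T', A x y ∧ ¬ A y x) ∧
    (∀ y ∈ T', ∀ x ∈ {x | f x = i} \ S, A y x ∧ ¬ A x y)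

/-- Type III. -/
def TypeIII (A : V → V → Prop) {m : ℕ} (f : V → Fin m) (r : ℕ) (α β : ℕ → ℤ) : Prop :=
  2 * (β 1 + β 2 - α 1 - α 2) = (r : ℤ) ∧
  ∀ i j : Fin m, i ≠ j →
    (∀ x y : V, f x = i → f y = j → A x y ∧ A y x) ∨
    (TypeIIIsplitB A f i j ∨ TypeIIIsplitB A f j i) ∨
    TypeIIIsplitC A f i j

/-- An `(m,r)`-team tournament: an `(m,r)`-team semicomplete multipartite digraph with
no pair of opposite arcs. -/
def IsTeamTournament (A : V → V → Prop) {m : ℕ} (f : V → Fin m) (r : ℕ) : Prop :=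
  IsTeamSMD A f r ∧ ∀ x y : V, ¬ (A x y ∧ A y x)

open Classical in
/-- A doubly regular `(m,r)`-team tournament with parameters `(α,β,γ)`:
`A² = αA + βAᵀ + γ(J - I - A - Aᵀ)`. -/
def IsDRTeamTournament [Fintype V] (A : V → V → Prop) {m : ℕ} (f : V → Fin m) (r : ℕ)
    (α β γ : ℤ) : Prop :=
  IsTeamTournament A f r ∧ (∃ k, IsRegularOfValency A k) ∧
  matAdj A * matAdj A =
    α • matAdj A + β • (matAdj A)ᵀ + γ • (matJ V - 1 - matAdj A - (matAdj A)ᵀ)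

/-- Type II of a doubly regular team tournament: `β - α = 0`, `r` even, and
`|N⁺(x) ∩ V_i| = r/2` for every partite set `V_i` and vertex `x ∉ V_i`. -/
def TournamentTypeII (A : V → V → Prop) {m : ℕ} (f : V → Fin m) (r : ℕ) (α β : ℤ) : Prop :=
  β = α ∧ Even r ∧ ∀ (i : Fin m) (x : V), f x ≠ i → 2 * {y | f y = i ∧ A x y}.ncard = r

/-- The Cayley digraph `Cay(ℤ₆, {1,2})`. -/
def Cay6 : ZMod 6 → ZMod 6 → Prop := fun x y => y - x = 1 ∨ y - x = 2

/-- The directed cycle `C₄`. -/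
def C4 : ZMod 4 → ZMod 4 → Prop := fun x y => y = x + 1

section Distances

variable {A : V → V → Prop}

theorem ddist_le {x y : V} {n : ℕ} (h : HasPathOfLength A x y n) : ddist A x y ≤ n :=
  Nat.sInf_le h

theorem hasPath_ddist (h : IsStronglyConnected A) (x y : V) :
    HasPathOfLength A x y (ddist A x y) :=
  Nat.sInf_mem (s := {n | HasPathOfLength A x y n}) (h x y)

theorem hasPath_zero {x y : V} : HasPathOfLength A x y 0 ↔ x = y := by
  constructor
  · rintro ⟨p, h0, h1, -⟩
    exact h0.symm.trans h1
  · rintro rfl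
    exact ⟨fun _ => x, rfl, rfl, by simp⟩

theorem hasPath_one {x y : V} : HasPathOfLength A x y 1 ↔ A x y := by
  constructor
  · rintro ⟨p, rfl, rfl, h⟩
    exact h 0 one_pos
  · intro h
    refine ⟨fun i => if i = 0 then x else y, rfl, rfl, fun i hi => ?_⟩
    obtain rfl : i = 0 := by omega
    simpa using h

theorem HasPathOfLength.cons {x y z : V} {n : ℕ} (h : A x y) (hp : HasPathOfLength A y z n) :
    HasPathOfLength A x z (n + 1) := by
  obtain ⟨p, rfl, rfl, hp⟩ := hp
  refine ⟨fun i => Nat.casesOn i x p, rfl, rfl, fun i hi => ?_⟩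
  cases i with
  | zero => exact h
  | succ j => exact hp j (by omega)

theorem HasPathOfLength.reverse (hA : ∀ x y, A x y → A y x) {x y : V} {n : ℕ}
    (hp : HasPathOfLength A x y n) : HasPathOfLength A y x n := by
  obtain ⟨p, rfl, rfl, hp⟩ := hp
  refine ⟨fun i => p (n - i), by simp, by simp, fun i hi => hA _ _ ?_⟩
  have h := hp (n - (i + 1)) (by omega)
  rwa [show n - (i + 1) + 1 = n - i by omega] at h

theorem ddist_eq_zero (h : IsStronglyConnected A) {x y : V} : ddist A x y = 0 ↔ x = y := by
  constructor
  · intro h0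
    have hp := hasPath_ddist h x y
    rw [h0] at hp
    exact hasPath_zero.1 hp
  · intro hxy
    exact Nat.le_zero.1 (ddist_le (hasPath_zero.2 hxy))

theorem ddist_eq_one (h : IsStronglyConnected A) (hirr : ∀ x, ¬ A x x) {x y : V} :
    ddist A x y = 1 ↔ A x y := by
  constructor
  · intro h1
    have hp := hasPath_ddist h x y
    rw [h1] at hp
    exact hasPath_one.1 hp
  · intro hxy
    have hle := ddist_le (hasPath_one.2 hxy)
    have hne : ddist A x y ≠ 0 := fun h0 => by
      rw [ddist_eq_zero h] at h0
      exact hirr _ (h0 ▸ hxy)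
    omega

theorem ddist_le_two {x y z : V} (h₁ : A x y) (h₂ : A y z) : ddist A x z ≤ 2 :=
  ddist_le (.cons h₁ (hasPath_one.2 h₂))

theorem ddist_le_three {x y z w : V} (h₁ : A x y) (h₂ : A y z) (h₃ : A z w) :
    ddist A x w ≤ 3 :=
  ddist_le (.cons h₁ (.cons h₂ (hasPath_one.2 h₃)))

theorem ddist_comm_of_symm (hA : ∀ x y, A x y → A y x) (x y : V) :
    ddist A x y = ddist A y x := by
  unfold ddist
  congr 1
  ext n
  exact ⟨.reverse hA, .reverse hA⟩

theorem exists_oneWay_arc (h : IsWDRD A) : ∃ x y, A x y ∧ ¬ A y x := by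
  by_contra! hA
  obtain ⟨-, ⟨_, ⟨x, y, rfl⟩, hne⟩, -⟩ := h
  exact hne (ddist_comm_of_symm hA x y)

theorem tdist_swap_eq {x y x' y' : V} (h : tdist A x y = tdist A x' y') :
    tdist A y x = tdist A y' x' := by
  simp only [tdist, Prod.mk.injEq] at h ⊢
  exact h.symm

end Distances

section Counting

variable [Fintype V] {A : V → V → Prop}

open Classical in
/-- The number of `z` such that `∂̃(x,z)` satisfies `P` and `∂̃(z,y)` satisfies `Q`. -/
noncomputable def pcount (A : V → V → Prop) (P Q : ℕ × ℕ → Prop) (x y : V) : ℕ :=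
  (Finset.univ.filter fun z => P (tdist A x z) ∧ Q (tdist A z y)).card

open Classical in
theorem pcount_eq_sum (P Q : ℕ × ℕ → Prop) (x y : V) :
    pcount A P Q x y =
      ∑ i ∈ (Finset.univ.image fun p : V × V => tdist A p.1 p.2).filter P,
        ∑ j ∈ (Finset.univ.image fun p : V × V => tdist A p.1 p.2).filter Q,
          pnum A i j x y := by
  rw [← Finset.sum_product', pcount, Finset.card_eq_sum_card_fiberwise
    (f := fun z => (tdist A x z, tdist A z y))
    (t := (Finset.univ.image fun p : V × V => tdist A p.1 p.2).filter P ×ˢ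
      (Finset.univ.image fun p : V × V => tdist A p.1 p.2).filter Q)]
  · refine Finset.sum_congr rfl fun ij hij => ?_
    rw [pnum, Set.ncard_eq_toFinset_card']
    congr 1
    ext z
    simp only [Finset.mem_product, Finset.mem_filter] at hij
    simp only [Finset.mem_filter, Finset.mem_univ, true_and, Set.mem_toFinset,
      Set.mem_ofPred_eq, Prod.ext_iff]
    refine and_iff_right_of_imp ?_
    rintro ⟨h₁, h₂⟩
    rw [← Prod.ext_iff] at h₁ h₂
    exact ⟨h₁ ▸ hij.1.2, h₂ ▸ hij.2.2⟩
  · intro z hz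
    simp only [Finset.coe_filter, Finset.mem_univ, true_and, Set.mem_ofPred_eq] at hz
    simp only [Finset.coe_product, Set.mem_prod, Finset.mem_coe, Finset.mem_filter,
      Finset.mem_image, Finset.mem_univ, true_and, Prod.exists]
    exact ⟨⟨⟨x, z, rfl⟩, hz.1⟩, ⟨z, y, rfl⟩, hz.2⟩

theorem pcount_congr (h : IsWDRD A) (P Q : ℕ × ℕ → Prop) {x y x' y' : V}
    (hxy : tdist A x y = tdist A x' y') : pcount A P Q x y = pcount A P Q x' y' := by
  simp only [pcount_eq_sum]
  exact Finset.sum_congr rfl fun i _ => Finset.sum_congr rfl fun j _ =>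
    h.2.2 i j x y x' y' hxy

theorem pcount_comm (h : IsCommutativeDigraph A) (P Q : ℕ × ℕ → Prop) (x y : V) :
    pcount A P Q x y = pcount A Q P x y := by
  simp only [pcount_eq_sum]
  rw [Finset.sum_comm]
  exact Finset.sum_congr rfl fun i _ => Finset.sum_congr rfl fun j _ => h _ _ _ _

open Classical in
theorem card_filter_tdist (h : IsWDRD A) (P : ℕ × ℕ → Prop) (x x' : V) :
    (Finset.univ.filter fun z => P (tdist A x z)).card =
      (Finset.univ.filter fun z => P (tdist A x' z)).card := by
  have hx : tdist A x x = tdist A x' x' := by simp [tdist, (ddist_eq_zero h.1).2]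
  simpa [pcount] using pcount_congr h P (fun _ => True) hx

end Counting

section Blocks

variable {A : V → V → Prop} {m : ℕ} {f : V → Fin m}

theorem adj_iff (hs : IsSemicompleteMultipartiteWith A f) {x y : V} :
    (A x y ∨ A y x) ↔ f x ≠ f y := by
  by_cases hxy : x = y
  · subst hxy
    simp [hs.1 x]
  · exact hs.2.2 x y hxy

theorem ne_of_arc (hs : IsSemicompleteMultipartiteWith A f) {x y : V} (h : A x y) :
    f x ≠ f y :=
  (adj_iff hs).1 (.inl h)

theorem samePart_iff (hs : IsSemicompleteMultipartiteWith A f) (h : IsStronglyConnected A)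
    {x y : V} : f x = f y ↔ (tdist A x y).1 ≠ 1 ∧ (tdist A x y).2 ≠ 1 := by
  have := adj_iff hs (x := x) (y := y)
  simp only [tdist, ne_eq, ddist_eq_one h hs.1]
  tauto

/-- The two-way distances of arcs. -/
def IsArcType (d : ℕ × ℕ) : Prop := d.1 = 1

/-- The two-way distance of pairs of opposite arcs. -/
def IsEdgeType (d : ℕ × ℕ) : Prop := d = (1, 1)

theorem isArcType_iff (hs : IsSemicompleteMultipartiteWith A f) (h : IsStronglyConnected A)
    {x y : V} : IsArcType (tdist A x y) ↔ A x y :=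
  ddist_eq_one h hs.1

theorem isEdgeType_iff (hs : IsSemicompleteMultipartiteWith A f) (h : IsStronglyConnected A)
    {x y : V} : IsEdgeType (tdist A x y) ↔ A x y ∧ A y x := by
  simp [IsEdgeType, tdist, ddist_eq_one h hs.1]

variable [Fintype V]

open Classical in
/-- The number of `z` in the part of `y` such that `∂̃(x,z)` satisfies `P`. -/
noncomputable def blockCount (A : V → V → Prop) (f : V → Fin m) (P : ℕ × ℕ → Prop)
    (x y : V) : ℕ :=
  (Finset.univ.filter fun z => P (tdist A x z) ∧ f z = f y).card

theorem blockCount_eq_pcount (hs : IsSemicompleteMultipartiteWith A f)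
    (h : IsStronglyConnected A) (P : ℕ × ℕ → Prop) (x y : V) :
    blockCount A f P x y = pcount A P (fun d => d.1 ≠ 1 ∧ d.2 ≠ 1) x y := by
  rw [blockCount, pcount]
  congr 1
  ext z
  simp only [Finset.mem_filter, samePart_iff hs h]

theorem blockCount_congr (hs : IsSemicompleteMultipartiteWith A f) (h : IsWDRD A)
    (P : ℕ × ℕ → Prop) {x y x' y' : V} (hxy : tdist A x y = tdist A x' y') :
    blockCount A f P x y = blockCount A f P x' y' := by
  simpa only [blockCount_eq_pcount hs h.1] using pcount_congr h P _ hxy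

open Classical in
theorem blockCount_eq_card_in (hs : IsSemicompleteMultipartiteWith A f) (h : IsCWDRD A)
    (P : ℕ × ℕ → Prop) (x y : V) :
    blockCount A f P x y =
      (Finset.univ.filter fun z => f z = f x ∧ P (tdist A z y)).card := by
  rw [blockCount_eq_pcount hs h.1.1, pcount_comm h.2, pcount]
  congr 1
  ext z
  simp [eq_comm (a := f z), samePart_iff hs h.1.1 (x := x)]

theorem blockCount_const (hs : IsSemicompleteMultipartiteWith A f) (h : IsCWDRD A)
    (P : ℕ × ℕ → Prop) {x y x' y' : V} (hx : f x = f x') (hy : f y = f y') :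
    blockCount A f P x y = blockCount A f P x' y' := by
  trans blockCount A f P x y'
  · rw [blockCount, blockCount, hy]
  · rw [blockCount_eq_card_in hs h, blockCount_eq_card_in hs h, hx]

theorem blockCount_pos_iff (P : ℕ × ℕ → Prop) {x y : V} :
    0 < blockCount A f P x y ↔ ∃ z, P (tdist A x z) ∧ f z = f y := by
  simp [blockCount, Finset.card_pos, Finset.Nonempty]

open Classical in
/-- For an arc `(x,y)` lying in no circuit of length at most three, the out-neighbours of `x`
in the part of `y` and the edge neighbours of `x` outside this part together number at most
the out-neighbours of `y` in the part of `x`. -/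
theorem blockCount_add_le (hs : IsSemicompleteMultipartiteWith A f) (h : IsWDRD A)
    {x y : V} (h2 : ∀ v, A y v → ¬ A v x) :
    blockCount A f IsArcType x y +
      (Finset.univ.filter fun z => (A x z ∧ A z x) ∧ f z ≠ f y).card ≤
      blockCount A f IsArcType y x := by
  have hk := card_filter_tdist h IsArcType x y
  simp only [blockCount, isArcType_iff hs h.1] at hk ⊢
  have h₁ := Finset.card_filter_add_card_filter_not
    (s := Finset.univ.filter fun z => A x z) (fun z => f z = f y)
  have h₂ := Finset.card_filter_add_card_filter_not
    (s := Finset.univ.filter fun z => A y z) (fun z => f z = f x)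
  simp only [Finset.filter_filter] at h₁ h₂
  have h₃ : (Finset.univ.filter fun z => A y z ∧ ¬ f z = f x).card +
      (Finset.univ.filter fun z => (A x z ∧ A z x) ∧ f z ≠ f y).card ≤
      (Finset.univ.filter fun z => A x z ∧ ¬ f z = f y).card := by
    rw [← Finset.card_union_of_disjoint]
    · refine Finset.card_le_card fun z hz => ?_
      simp only [Finset.mem_union, Finset.mem_filter, Finset.mem_univ, true_and] at hz ⊢
      rcases hz with ⟨hyz, hzx⟩ | hz
      · exact ⟨((adj_iff hs).2 hzx).resolve_left (h2 z hyz), (ne_of_arc hs hyz).symm⟩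
      · exact ⟨hz.1.1, hz.2⟩
    · rw [Finset.disjoint_filter]
      rintro z - ⟨hyz, -⟩ ⟨⟨-, hzx⟩, -⟩
      exact h2 z hyz hzx
  omega

theorem ddist_reverse_arc_le (hs : IsSemicompleteMultipartiteWith A f) (h : IsCWDRD A)
    {x y : V} (hxy : A x y) : ddist A y x ≤ 3 := by
  classical
  by_contra! hlt
  have h1 : ¬ A y x := fun hyx => by
    have := (ddist_eq_one h.1.1 hs.1).2 hyx
    omega
  have h2 : ∀ v, A y v → ¬ A v x := fun v hyv hvx => by
    have := ddist_le_two hyv hvx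
    omega
  have h3 : ∀ w u, A y w → A w u → ¬ A u x := fun w u hyw hwu hux => by
    have := ddist_le_three hyw hwu hux
    omega
  have hle := blockCount_add_le hs h.1 h2
  have hpos : 0 < blockCount A f IsArcType x y :=
    (blockCount_pos_iff _).2 ⟨y, (isArcType_iff hs h.1.1).2 hxy, rfl⟩
  have hU : 0 < blockCount A f IsArcType y x := by omega
  have hU' := hU
  rw [blockCount_eq_card_in hs h] at hU'
  obtain ⟨u, hu⟩ := Finset.card_pos.1 hU'
  simp only [Finset.mem_filter, Finset.mem_univ, true_and, isArcType_iff hs h.1.1] at hu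
  have hconst := blockCount_const hs h IsArcType hu.1 (rfl : f x = f x)
  refine hconst.not_gt (Finset.card_lt_card ?_)
  simp only [isArcType_iff hs h.1.1]
  refine Finset.ssubset_iff_subset_ne.2 ⟨fun w hw => ?_, fun heq => ?_⟩
  · simp only [Finset.mem_filter, Finset.mem_univ, true_and] at hw ⊢
    have hne : f u ≠ f w := by
      rw [hu.1, hw.2]
      exact (ne_of_arc hs hxy).symm
    exact ⟨((adj_iff hs).2 hne).resolve_right fun hwu => h3 w u hw.1 hwu hu.2, hw.2⟩
  · have hx : x ∈ Finset.univ.filter fun z => A u z ∧ f z = f x := by simp [hu.2]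
    rw [← heq] at hx
    simp [h1] at hx

open Classical in
/-- If the parts of `x` and `v` are joined by edges and by equally many arcs in both
directions, then distinct vertices in the part of `x` are at two-way distance `(2,2)`. -/
theorem tdist_eq_two_two (hs : IsSemicompleteMultipartiteWith A f) (h : IsCWDRD A)
    {x v : V} (hxv : A x v) (hvx : A v x)
    (hd : blockCount A f IsArcType x v = blockCount A f IsArcType v x)
    {x₁ x₂ : V} (h₁ : f x₁ = f x) (h₂ : f x₂ = f x) (hne : x₁ ≠ x₂) :
    tdist A x₁ x₂ = (2, 2) := by
  have hpart : (Finset.univ.filter fun z => f z = f v).card <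
      blockCount A f IsArcType x v + blockCount A f IsArcType v x := by
    rw [blockCount_eq_card_in hs h _ v x, blockCount, ← Finset.card_union_add_card_inter]
    simp only [isArcType_iff hs h.1.1]
    have hinter : 0 < ((Finset.univ.filter fun z => A x z ∧ f z = f v) ∩
        (Finset.univ.filter fun z => f z = f v ∧ A z x)).card :=
      Finset.card_pos.2 ⟨v, by simp [hxv, hvx]⟩
    refine lt_of_le_of_lt ?_ (Nat.lt_add_of_pos_right hinter)
    refine Finset.card_le_card fun z hz => ?_
    simp only [Finset.mem_union, Finset.mem_filter, Finset.mem_univ, true_and] at hz ⊢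
    have hxz : f x ≠ f z := hz ▸ ne_of_arc hs hxv
    have := (adj_iff hs).2 hxz
    tauto
  have key : ∀ x₁ x₂, f x₁ = f x → f x₂ = f x → x₁ ≠ x₂ → ddist A x₁ x₂ = 2 := by
    intro x₁ x₂ h₁ h₂ hne
    have hout := blockCount_const hs h IsArcType h₁ (rfl : f v = f v)
    have hin := blockCount_const hs h IsArcType (rfl : f v = f v) h₂
    rw [blockCount_eq_card_in hs h _ v x₂] at hin
    rw [blockCount] at hout
    simp only [isArcType_iff hs h.1.1] at hin hout
    obtain ⟨z, hz⟩ : ((Finset.univ.filter fun z => A x₁ z ∧ f z = f v) ∩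
        (Finset.univ.filter fun z => f z = f v ∧ A z x₂)).Nonempty := by
      by_contra! hempty
      have hunion := Finset.card_union_add_card_inter
        (Finset.univ.filter fun z => A x₁ z ∧ f z = f v)
        (Finset.univ.filter fun z => f z = f v ∧ A z x₂)
      have hle : ((Finset.univ.filter fun z => A x₁ z ∧ f z = f v) ∪
          (Finset.univ.filter fun z => f z = f v ∧ A z x₂)).card ≤
          (Finset.univ.filter fun z => f z = f v).card := by
        refine Finset.card_le_card fun z hz => ?_
        simp only [Finset.mem_union, Finset.mem_filter, Finset.mem_univ, true_and] at hz ⊢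
        tauto
      rw [hempty, Finset.card_empty] at hunion
      omega
    simp only [Finset.mem_inter, Finset.mem_filter, Finset.mem_univ, true_and] at hz
    have hle := ddist_le_two hz.1.1 hz.2.2
    have h0 : ddist A x₁ x₂ ≠ 0 := fun h0 => hne ((ddist_eq_zero h.1.1).1 h0)
    have h1 : ddist A x₁ x₂ ≠ 1 := fun h1 =>
      ne_of_arc hs ((ddist_eq_one h.1.1 hs.1).1 h1) (h₁.trans h₂.symm)
    omega
  simp [tdist, key x₁ x₂ h₁ h₂ hne, key x₂ x₁ h₂ h₁ hne.symm]

open Classical in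
/-- If an arc of type `(1,3)` and an edge join the same two parts, then these parts are joined
by equally many arcs in both directions, and all edges at the first part lead to the second. -/
theorem blockCount_symm_of_edge (hs : IsSemicompleteMultipartiteWith A f) (h : IsCWDRD A)
    {x y v : V} (hxy : tdist A x y = (1, 3)) (hxv : A x v) (hvx : A v x) (hvy : f v = f y) :
    blockCount A f IsArcType x y = blockCount A f IsArcType y x ∧
      ∀ z, A x z → A z x → f z = f y := by
  have hlong : ∀ p q, tdist A p q = (1, 3) → ∀ z, A q z → ¬ A z p := by
    intro p q hpq z hqz hzp
    have hle := ddist_le_two hqz hzp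
    simp only [tdist, Prod.mk.injEq] at hpq
    omega
  have hrev : 0 < blockCount A f (· = (1, 3)) v x := by
    have hvx' : tdist A v x = tdist A x v := by
      simp [tdist, (ddist_eq_one h.1.1 hs.1).2 hxv, (ddist_eq_one h.1.1 hs.1).2 hvx]
    rw [blockCount_congr hs h.1 _ hvx', blockCount_pos_iff]
    exact ⟨y, hxy, hvy.symm⟩
  obtain ⟨w, hvw, hwx⟩ := (blockCount_pos_iff _).1 hrev
  have h₁ := blockCount_add_le hs h.1 (hlong x y hxy)
  have h₂ := blockCount_add_le hs h.1 (hlong v w hvw)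
  rw [blockCount_const hs h IsArcType hvy hwx, blockCount_const hs h IsArcType hwx hvy] at h₂
  refine ⟨by omega, fun z hxz hzx => ?_⟩
  by_contra hzy
  have hpos : 0 < (Finset.univ.filter fun z => (A x z ∧ A z x) ∧ f z ≠ f y).card :=
    Finset.card_pos.2 ⟨z, by simp [hxz, hzx, hzy]⟩
  omega

open Classical in
/-- An arc of type `(1,3)` and an edge do not join the same two parts. -/
theorem blockCount_edge_eq_zero (hs : IsSemicompleteMultipartiteWith A f) (h : IsCWDRD A)
    {x y : V} (hxy : tdist A x y = (1, 3)) : blockCount A f IsEdgeType x y = 0 := by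
  by_contra hne
  obtain ⟨v, hv, hvy⟩ := (blockCount_pos_iff _).1 (Nat.pos_of_ne_zero hne)
  rw [isEdgeType_iff hs h.1.1] at hv
  have harc : A x y := (isArcType_iff hs h.1.1).1 (by rw [hxy]; rfl)
  have hnarc : ¬ A y x := fun hyx => by
    have hyx' := (ddist_eq_one h.1.1 hs.1).2 hyx
    simp only [tdist, Prod.mk.injEq] at hxy
    omega
  have hd := (blockCount_symm_of_edge hs h hxy hv.1 hv.2 hvy).1
  have hX : ∀ x', f x' = f x → ∀ z, A x' z → A z x' → f z = f y := by
    intro x' hx' z hxz hzx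
    obtain ⟨y', hy', hyy'⟩ : ∃ y', tdist A x' y' = (1, 3) ∧ f y' = f y := by
      rw [← blockCount_pos_iff (A := A) (f := f) (P := (· = (1, 3))),
        blockCount_const hs h _ hx' (rfl : f y = f y), blockCount_pos_iff]
      exact ⟨y, hxy, rfl⟩
    obtain ⟨v', hv', hvy'⟩ : ∃ v', IsEdgeType (tdist A x' v') ∧ f v' = f y := by
      rw [← blockCount_pos_iff, blockCount_const hs h _ hx' (rfl : f y = f y)]
      exact Nat.pos_of_ne_zero hne
    rw [isEdgeType_iff hs h.1.1] at hv'
    rw [← hyy']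
    exact (blockCount_symm_of_edge hs h hy' hv'.1 hv'.2 (hvy'.trans hyy'.symm)).2 z hxz hzx
  have hedge_swap : tdist A x v = tdist A v x := by
    simp [tdist, (ddist_eq_one h.1.1 hs.1).2 hv.1, (ddist_eq_one h.1.1 hs.1).2 hv.2]
  have hY : ∀ z, A y z → A z y → f z = f x := by
    intro z hyz hzy
    obtain ⟨x', hx', hxx'⟩ : ∃ x', tdist A y x' = (1, 3) ∧ f x' = f x := by
      rw [← blockCount_pos_iff (A := A) (f := f) (P := (· = (1, 3))),
        blockCount_const hs h _ hvy.symm (rfl : f x = f x), ← blockCount_congr hs h.1 _ hedge_swap,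
        blockCount_pos_iff]
      exact ⟨y, hxy, hvy.symm⟩
    obtain ⟨u, hu, hux⟩ : ∃ u, IsEdgeType (tdist A y u) ∧ f u = f x := by
      rw [← blockCount_pos_iff, blockCount_const hs h _ hvy.symm (rfl : f x = f x),
        blockCount_pos_iff]
      exact ⟨x, (isEdgeType_iff hs h.1.1).2 hv.symm, rfl⟩
    rw [isEdgeType_iff hs h.1.1] at hu
    rw [← hxx']
    exact (blockCount_symm_of_edge hs h hx' hu.1 hu.2 (hux.trans hxx'.symm)).2 z hyz hzy
  have hd' : blockCount A f IsArcType x v = blockCount A f IsArcType v x := by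
    rw [blockCount_const hs h _ rfl hvy, hd, blockCount_const hs h _ hvy rfl]
  have hdistX : ∀ x₁ x₂, f x₁ = f x → f x₂ = f x → x₁ ≠ x₂ → tdist A x₁ x₂ = (2, 2) :=
    fun _ _ h₁ h₂ => tdist_eq_two_two hs h hv.1 hv.2 hd' h₁ h₂
  have hdistY : ∀ y₁ y₂, f y₁ = f y → f y₂ = f y → y₁ ≠ y₂ → tdist A y₁ y₂ = (2, 2) :=
    fun _ _ h₁ h₂ => tdist_eq_two_two hs h hv.2 hv.1 hd'.symm (h₁.trans hvy.symm)
      (h₂.trans hvy.symm)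
  have hbalance : ∀ x', f x' = f x →
      ∑ z, (if A x' z ∧ A z x' then ((if A x z then 1 else 0) - (if A z x then 1 else 0) : ℤ)
        else 0) = 0 := by
    intro x' hx'
    have hxx' : tdist A x x' = tdist A x' x := by
      by_cases heq : x = x'
      · rw [heq]
      · rw [hdistX x x' rfl hx' heq, hdistX x' x hx' rfl (Ne.symm heq)]
    have hcount : pcount A IsArcType IsEdgeType x x' = pcount A IsEdgeType IsArcType x' x :=
      (pcount_comm h.2 _ _ _ _).trans (pcount_congr h.1 _ _ hxx')
    simp only [pcount, isArcType_iff hs h.1.1, isEdgeType_iff hs h.1.1,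
      Finset.card_filter] at hcount
    zify at hcount
    rw [← sub_eq_zero, ← Finset.sum_sub_distrib] at hcount
    refine (Finset.sum_congr rfl fun z _ => ?_).trans hcount
    by_cases h₁ : A x' z <;> by_cases h₂ : A z x' <;> by_cases h₃ : A x z <;>
      by_cases h₄ : A z x <;> simp [h₁, h₂, h₃, h₄]
  have hsum : ∑ z, (pcount A IsEdgeType IsEdgeType y z : ℤ) *
      ((if A x z then 1 else 0) - (if A z x then 1 else 0)) = 0 := by
    trans ∑ x', if A y x' ∧ A x' y then
      ∑ z, (if A x' z ∧ A z x' then ((if A x z then 1 else 0) - (if A z x then 1 else 0) : ℤ)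
        else 0) else 0
    · simp only [pcount, isEdgeType_iff hs h.1.1, Finset.card_filter, Nat.cast_sum,
        Finset.sum_mul]
      rw [Finset.sum_comm]
      refine Finset.sum_congr rfl fun x' _ => ?_
      by_cases hx' : A y x' ∧ A x' y <;> simp [hx', ite_mul]
    · refine Finset.sum_eq_zero fun x' _ => ?_
      split_ifs with hx'
      · exact hbalance x' (hY x' hx'.1 hx'.2)
      · rfl
  have hvy_ne : v ≠ y := by
    rintro rfl
    exact hnarc hv.2
  have hval : ∀ z, (pcount A IsEdgeType IsEdgeType y z : ℤ) *
      ((if A x z then 1 else 0) - (if A z x then 1 else 0)) =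
      (if z = y then (pcount A IsEdgeType IsEdgeType y y : ℤ) -
        pcount A IsEdgeType IsEdgeType y v else 0) +
      pcount A IsEdgeType IsEdgeType y v * ((if A x z ∧ f z = f y then 1 else 0) -
        (if f z = f y ∧ A z x then 1 else 0)) := by
    intro z
    by_cases hz : f z = f y
    · by_cases hzy : z = y
      · subst hzy
        simp [harc, hnarc]
      · have htd : tdist A y z = tdist A y v := by
          rw [hdistY y z rfl hz (Ne.symm hzy), hdistY y v rfl hvy hvy_ne.symm]
        rw [pcount_congr h.1 _ _ htd]
        simp [hz, hzy]
    · have hzero : pcount A IsEdgeType IsEdgeType y z = 0 := by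
        simp only [pcount, isEdgeType_iff hs h.1.1, Finset.card_eq_zero,
          Finset.filter_eq_empty_iff, Finset.mem_univ, true_implies]
        rintro x' ⟨h₁, h₂⟩
        exact hz (hX x' (hY x' h₁.1 h₁.2) z h₂.1 h₂.2)
      have hzy : z ≠ y := fun hzy => hz (hzy ▸ rfl)
      simp [hz, hzy, hzero]
  have hcancel : ∑ z, ((if A x z ∧ f z = f y then 1 else 0) -
      (if f z = f y ∧ A z x then 1 else 0) : ℤ) = 0 := by
    rw [blockCount_eq_card_in hs h _ y x, blockCount] at hd
    simp only [isArcType_iff hs h.1.1, Finset.card_filter] at hd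
    zify at hd
    rw [Finset.sum_sub_distrib, hd, sub_self]
  simp only [hval, Finset.sum_add_distrib, ← Finset.mul_sum, hcancel, mul_zero, add_zero,
    Finset.sum_ite_eq', Finset.mem_univ, if_true, sub_eq_zero, Nat.cast_inj] at hsum
  have hvv : pcount A IsEdgeType IsEdgeType y y = pcount A IsEdgeType IsEdgeType v v :=
    pcount_congr h.1 _ _ (by simp [tdist, (ddist_eq_zero h.1.1).2])
  have hlt : pcount A IsEdgeType IsEdgeType y v < pcount A IsEdgeType IsEdgeType v v := by
    simp only [pcount, isEdgeType_iff hs h.1.1]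
    refine Finset.card_lt_card (Finset.ssubset_iff_subset_ne.2 ⟨fun z hz => ?_, fun heq => ?_⟩)
    · simp only [Finset.mem_filter, Finset.mem_univ, true_and] at hz ⊢
      exact ⟨hz.2.symm, hz.2⟩
    · have hx : x ∈ Finset.univ.filter fun z => (A v z ∧ A z v) ∧ A z v ∧ A v z := by
        simp [hv]
      rw [← heq] at hx
      simp [hnarc] at hx
  omega

open Classical in
/-- Types `(1,3)` and `(1,1)` do not occur simultaneously. -/
theorem no_edge_of_long_arc (hs : IsSemicompleteMultipartiteWith A f) (h : IsCWDRD A)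
    {x y p q : V} (hxy : tdist A x y = (1, 3)) (hpq : A p q) (hqp : A q p) : False := by
  have harc : A x y := (isArcType_iff hs h.1.1).1 (by rw [hxy]; rfl)
  have hsep : ∀ p q, 0 < blockCount A f (· = (1, 3)) p q → blockCount A f IsEdgeType p q = 0 := by
    intro p q hpos
    obtain ⟨z, hz, hzq⟩ := (blockCount_pos_iff _).1 hpos
    rw [← blockCount_const hs h IsEdgeType rfl hzq]
    exact blockCount_edge_eq_zero hs h hz
  have hlong : ∀ x y, tdist A x y = (1, 3) → ∀ v, A y v → ¬ A v x := by
    intro x y hxy v hyv hvx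
    have hle := ddist_le_two hyv hvx
    simp only [tdist, Prod.mk.injEq] at hxy
    omega
  have hedge : ∀ x, ∃ z, A x z ∧ A z x := by
    intro x
    have hcard := card_filter_tdist h.1 IsEdgeType p x
    simp only [isEdgeType_iff hs h.1.1] at hcard
    have hpos : 0 < (Finset.univ.filter fun z => A p z ∧ A z p).card :=
      Finset.card_pos.2 ⟨q, by simp [hpq, hqp]⟩
    rw [hcard] at hpos
    obtain ⟨z, hz⟩ := Finset.card_pos.1 hpos
    exact ⟨z, by simpa using hz⟩
  have hlt : ∀ x y, tdist A x y = (1, 3) →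
      blockCount A f IsArcType x y < blockCount A f IsArcType y x := by
    intro x y hxy
    obtain ⟨z, hxz, hzx⟩ := hedge x
    have hzy : f z ≠ f y := fun hzy => by
      have h0 : 0 < blockCount A f IsEdgeType x y :=
        (blockCount_pos_iff _).2 ⟨z, (isEdgeType_iff hs h.1.1).2 ⟨hxz, hzx⟩, hzy⟩
      exact h0.ne' (blockCount_edge_eq_zero hs h hxy)
    have hpos : 0 < (Finset.univ.filter fun z => (A x z ∧ A z x) ∧ f z ≠ f y).card :=
      Finset.card_pos.2 ⟨z, by simp [hxz, hzx, hzy]⟩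
    have := blockCount_add_le hs h.1 (hlong x y hxy)
    omega
  have hout : 0 < blockCount A f IsArcType x y :=
    (blockCount_pos_iff _).2 ⟨y, (isArcType_iff hs h.1.1).2 harc, rfl⟩
  have hback : 0 < blockCount A f IsArcType y x := hout.trans (hlt x y hxy)
  have hcases : ∀ p q, A p q → ¬ A q p → tdist A p q = (1, 2) ∨ tdist A p q = (1, 3) := by
    intro p q hpq hqp
    have h1 := (ddist_eq_one h.1.1 hs.1).2 hpq
    have h2 : ddist A q p ≠ 1 := fun h2 => hqp ((ddist_eq_one h.1.1 hs.1).1 h2)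
    have h3 := ddist_reverse_arc_le hs h hpq
    have h4 : ddist A q p ≠ 0 := fun h4 => hs.1 p (by
      rw [ddist_eq_zero h.1.1] at h4
      rwa [h4] at hpq)
    simp only [tdist, Prod.mk.injEq, h1, true_and]
    omega
  obtain ⟨w, hyw, hwx⟩ := (blockCount_pos_iff _).1 hback
  rw [isArcType_iff hs h.1.1] at hyw
  have hwy : ¬ A w y := fun hwy => by
    have h0 : 0 < blockCount A f IsEdgeType w y :=
      (blockCount_pos_iff _).2 ⟨y, (isEdgeType_iff hs h.1.1).2 ⟨hwy, hyw⟩, rfl⟩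
    rw [blockCount_const hs h _ hwx rfl, blockCount_edge_eq_zero hs h hxy] at h0
    exact h0.false
  have htyw : tdist A y w = (1, 2) := by
    refine (hcases y w hyw hwy).resolve_right fun htyw => ?_
    have h₁ := hlt x y hxy
    have h₂ := hlt y w htyw
    rw [blockCount_const hs h IsArcType rfl hwx, blockCount_const hs h IsArcType hwx rfl] at h₂
    omega
  have hshort : ∀ p q, tdist A p q = (1, 2) →
      0 < blockCount A f (· = (1, 3)) q p ∧ 0 < blockCount A f IsArcType q p := by
    intro p q htpq
    have htqp : tdist A q p = tdist A w y := tdist_swap_eq (htpq.trans htyw.symm)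
    rw [blockCount_congr hs h.1 _ htqp, blockCount_congr hs h.1 _ htqp,
      blockCount_const hs h _ hwx rfl, blockCount_const hs h _ hwx rfl]
    exact ⟨(blockCount_pos_iff _).2 ⟨y, hxy, rfl⟩, hout⟩
  have hsep' : ∀ p q, A p q → ¬ A q p →
      blockCount A f IsEdgeType p q = 0 ∨ blockCount A f IsEdgeType q p = 0 := by
    intro p q hpq hqp
    rcases hcases p q hpq hqp with ht | ht
    · exact .inr (hsep q p (hshort p q ht).1)
    · exact .inl (blockCount_edge_eq_zero hs h ht)
  obtain ⟨z, hxz, hzx⟩ := hedge x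
  have hZ : ∀ z', f z' = f z → A z' x := by
    intro z' hz'
    have h₁ : 0 < blockCount A f IsEdgeType x z' := (blockCount_pos_iff _).2
      ⟨z, (isEdgeType_iff hs h.1.1).2 ⟨hxz, hzx⟩, hz'.symm⟩
    have h₂ : 0 < blockCount A f IsEdgeType z' x := by
      rw [blockCount_const hs h _ hz' rfl]
      exact (blockCount_pos_iff _).2 ⟨x, (isEdgeType_iff hs h.1.1).2 ⟨hzx, hxz⟩, rfl⟩
    by_contra hzx'
    have hxz' : A x z' :=
      ((adj_iff hs).2 (hz' ▸ ne_of_arc hs hxz)).resolve_right hzx'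
    rcases hsep' x z' hxz' hzx' with h0 | h0 <;> omega
  have hyz : blockCount A f IsArcType y z = 0 := by
    by_contra hne
    obtain ⟨z', hyz', hz'⟩ := (blockCount_pos_iff _).1 (Nat.pos_of_ne_zero hne)
    exact hlong x y hxy z' ((isArcType_iff hs h.1.1).1 hyz') (hZ z' hz')
  have hnyz : ¬ A y z := fun h0 => hlong x y hxy z h0 hzx
  have hzy : A z y := by
    refine ((adj_iff hs).2 fun hzy => ?_).resolve_right hnyz
    have h0 : 0 < blockCount A f IsEdgeType x y :=
      (blockCount_pos_iff _).2 ⟨z, (isEdgeType_iff hs h.1.1).2 ⟨hxz, hzx⟩, hzy⟩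
    exact h0.ne' (blockCount_edge_eq_zero hs h hxy)
  rcases hcases z y hzy hnyz with ht | ht
  · exact (hshort z y ht).2.ne' hyz
  · rw [blockCount_congr hs h.1 _ (tdist_swap_eq (ht.trans hxy.symm))] at hyz
    omega

end Blocks

/-- `T = {3}`, `T = {4}`, `T = {3,4}` or `T = {2,3}`. -/
theorem statement_16 {V : Type*} [Fintype V] [Nonempty V] (A : V → V → Prop)
    (hsm : IsSemicompleteMultipartite A) (h : IsCWDRD A) :
    {q : ℕ | (1, q - 1) ∈ tdistSet A} = {3} ∨
    {q : ℕ | (1, q - 1) ∈ tdistSet A} = {4} ∨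
    {q : ℕ | (1, q - 1) ∈ tdistSet A} = {3, 4} ∨
    {q : ℕ | (1, q - 1) ∈ tdistSet A} = {2, 3} := by
  obtain ⟨m, -, f, hs⟩ := hsm
  have hmem : ∀ q, (1, q - 1) ∈ tdistSet A → q = 2 ∨ q = 3 ∨ q = 4 := by
    rintro q ⟨x, y, hxy⟩
    simp only [tdist, Prod.mk.injEq] at hxy
    have harc := (ddist_eq_one h.1.1 hs.1).1 hxy.1
    have hle := ddist_reverse_arc_le hs h harc
    have h0 : ddist A y x ≠ 0 := fun h0 => hs.1 x (by
      rw [ddist_eq_zero h.1.1] at h0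
      rwa [h0] at harc)
    omega
  have hexists : (1, 2) ∈ tdistSet A ∨ (1, 3) ∈ tdistSet A := by
    obtain ⟨x, y, hxy, hyx⟩ := exists_oneWay_arc h.1
    have h1 := (ddist_eq_one h.1.1 hs.1).2 hxy
    have hne : ddist A y x ≠ 1 := fun h1 => hyx ((ddist_eq_one h.1.1 hs.1).1 h1)
    have hT : (1, ddist A y x + 1 - 1) ∈ tdistSet A := ⟨x, y, by simp [tdist, h1]⟩
    have hq := hmem _ hT
    rcases (by omega : ddist A y x = 2 ∨ ddist A y x = 3) with h2 | h2 <;> rw [h2] at hT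
    · exact .inl hT
    · exact .inr hT
  have hexcl : ¬ ((1, 1) ∈ tdistSet A ∧ (1, 3) ∈ tdistSet A) := by
    rintro ⟨⟨p, q, hpq⟩, x, y, hxy⟩
    have hedge := (isEdgeType_iff hs h.1.1).1 hpq
    exact no_edge_of_long_arc hs h hxy hedge.1 hedge.2
  have hset : ∀ q, q ∈ {q : ℕ | (1, q - 1) ∈ tdistSet A} ↔
      (q = 2 ∧ (1, 1) ∈ tdistSet A) ∨ (q = 3 ∧ (1, 2) ∈ tdistSet A) ∨
        (q = 4 ∧ (1, 3) ∈ tdistSet A) := by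
    intro q
    constructor
    · intro hq
      obtain rfl | rfl | rfl := hmem q hq
      · exact .inl ⟨rfl, hq⟩
      · exact .inr (.inl ⟨rfl, hq⟩)
      · exact .inr (.inr ⟨rfl, hq⟩)
    · rintro (⟨rfl, hq⟩ | ⟨rfl, hq⟩ | ⟨rfl, hq⟩) <;> exact hq
  simp only [Set.ext_iff, hset, Set.mem_insert_iff, Set.mem_singleton_iff]
  by_cases h1 : (1, 1) ∈ tdistSet A <;> by_cases h2 : (1, 2) ∈ tdistSet A <;>
    by_cases h3 : (1, 3) ∈ tdistSet A <;> simp_all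

end Paper
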